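/- Let n ≥ 2, let μ ∈ (0,1], and let d ≠ 2 be a real number such that either d is not an integer, or −(n−2) < d < 0. Let F : Sym_n(ℝ) → ℝ be continuously differentiable and uniformly elliptic, in the sense that for every symmetric matrix M and every symmetric positive semidefinite matrix P one has μ·tr(P) ≤ DF(M)(P) ≤ μ⁻¹·tr(P). Suppose u : ℝⁿ → ℝ is twice continuously differentiable on ℝⁿ \ {0}, positively homogeneous of degree d, and satisfies F(D²u(x)) = 0 for all x ≠ 0. Then u ≡ 0 on ℝⁿ \ {0}. -/

import Mathlib

attribute [local instance] Matrix.normedAddCommGroup Matrix.normedSpace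

/-- The Hessian matrix of second partial derivatives of `u : ℝⁿ → ℝ`. -/
noncomputable def hessian {n : ℕ} (u : EuclideanSpace ℝ (Fin n) → ℝ)
    (x : EuclideanSpace ℝ (Fin n)) : Matrix (Fin n) (Fin n) ℝ :=
  Matrix.of fun i j =>
    fderiv ℝ (fun y => fderiv ℝ u y (EuclideanSpace.single j (1 : ℝ))) x
      (EuclideanSpace.single i (1 : ℝ))

section InnerProduct

open MeasureTheory

variable {E : Type*} [NormedAddCommGroup E] [InnerProductSpace ℝ E]

/-- The divergence of a vector field. -/
noncomputable def divergence (V : E → E) (x : E) : ℝ :=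
  LinearMap.trace ℝ E (fderiv ℝ V x : E →ₗ[ℝ] E)

lemma divergence_sub {V W : E → E} {x : E} (hV : DifferentiableAt ℝ V x)
    (hW : DifferentiableAt ℝ W x) :
    divergence (fun y => V y - W y) x = divergence V x - divergence W x := by
  simp [divergence, fderiv_fun_sub hV hW]

lemma divergence_add {V W : E → E} {x : E} (hV : DifferentiableAt ℝ V x)
    (hW : DifferentiableAt ℝ W x) :
    divergence (fun y => V y + W y) x = divergence V x + divergence W x := by
  simp [divergence, fderiv_fun_add hV hW]

lemma divergence_sum {ι : Type*} {s : Finset ι} {V : ι → E → E} {x : E}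
    (hV : ∀ i ∈ s, DifferentiableAt ℝ (V i) x) :
    divergence (fun y => ∑ i ∈ s, V i y) x = ∑ i ∈ s, divergence (V i) x := by
  simp [divergence, fderiv_fun_sum hV]

lemma divergence_smul [FiniteDimensional ℝ E] {c : E → ℝ} {c' : E →L[ℝ] ℝ} {W : E → E} {x : E}
    (hc : HasFDerivAt c c' x) (hW : DifferentiableAt ℝ W x) :
    divergence (fun y => c y • W y) x = c x * divergence W x + c' (W x) := by
  rw [divergence, (hc.fun_smul hW.hasFDerivAt).fderiv, ContinuousLinearMap.toLinearMap_add,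
    map_add, ContinuousLinearMap.toLinearMap_smul, map_smul]
  congr 1
  exact LinearMap.trace_smulRight (c' : E →ₗ[ℝ] ℝ) (W x)

lemma divergence_const (v x : E) : divergence (fun _ : E => v) x = 0 := by
  simp [divergence]

lemma divergence_id [FiniteDimensional ℝ E] (x : E) : divergence (fun y : E => y) x = Module.finrank ℝ E := by
  rw [divergence, fderiv_fun_id]
  exact LinearMap.trace_id ℝ E

open Topology in
lemma contDiff_smul_of_eventuallyEq_zero {G : E → ℝ} {v : E → E} (hG : ContDiff ℝ 1 G)
    (hG0 : G =ᶠ[𝓝 0] 0) (hv : ContDiffOn ℝ 1 v {0}ᶜ) : ContDiff ℝ 1 fun x => G x • v x := by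
  rw [contDiff_iff_contDiffAt]
  intro x
  rcases eq_or_ne x 0 with rfl | hx
  · refine (contDiffAt_const (c := (0 : E))).congr_of_eventuallyEq ?_
    filter_upwards [hG0] with y hy
    simp [hy]
  · exact hG.contDiffAt.smul (hv.contDiffAt (isOpen_compl_singleton.mem_nhds hx))

open Topology in
lemma continuous_mul_of_eventuallyEq_zero {E : Type*} [NormedAddCommGroup E] {G u : E → ℝ} (hG : Continuous G)
    (hG0 : G =ᶠ[𝓝 0] 0) (hu : ContinuousOn u {0}ᶜ) : Continuous fun x => G x * u x := by
  rw [continuous_iff_continuousAt]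
  intro x
  rcases eq_or_ne x 0 with rfl | hx
  · refine (continuousAt_const (y := (0 : ℝ))).congr ?_
    filter_upwards [hG0] with y hy
    simp [hy]
  · exact hG.continuousAt.mul (hu.continuousAt (isOpen_compl_singleton.mem_nhds hx))

lemma hasFDerivAt_quadratic {b : E →L[ℝ] E} (hb : ∀ y z, inner ℝ (b y) z = inner ℝ y (b z))
    (x : E) : HasFDerivAt (fun y : E => inner ℝ y (b y)) ((2 : ℝ) • innerSL ℝ (b x)) x := by
  refine ((hasFDerivAt_id x).inner ℝ b.hasFDerivAt).congr_fderiv ?_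
  ext y
  have h : inner ℝ x (b y) + inner ℝ y (b x) = 2 * inner ℝ (b x) y := by
    rw [← hb, real_inner_comm (b x) y, two_mul]
  simpa using h

variable [FiniteDimensional ℝ E]

lemma hasCompactSupport_comp_quadratic {b : E →L[ℝ] E} {c : ℝ} (hc : 0 < c)
    (hbc : ∀ x, c * ‖x‖ ^ 2 ≤ inner ℝ x (b x)) {g : ℝ → ℝ} (hg : HasCompactSupport g) :
    HasCompactSupport fun x => g (inner ℝ x (b x)) := by
  obtain ⟨R, hR⟩ := hg.isCompact.isBounded.exists_norm_le
  refine HasCompactSupport.intro (isCompact_closedBall (0 : E) (1 + R / c)) fun x hx => ?_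
  by_contra h
  have h1 := (le_abs_self _).trans (hR _ (subset_tsupport g h))
  have h2 : 1 + R / c < ‖x‖ := by simpa using hx
  have h3 : 0 ≤ R := (norm_nonneg _).trans (hR _ (subset_tsupport g h))
  have h4 : 0 ≤ R / c := by positivity
  have h5 : R / c < ‖x‖ ^ 2 := by nlinarith
  rw [div_lt_iff₀ hc] at h5
  linarith [hbc x, mul_comm c (‖x‖ ^ 2)]

/-- The hypotheses on `w` say that it is the field `a ∇u` and that it is divergence free; `u` is
homogeneous of degree `d` by the Euler identity. The field below is tangent to the level sets of
the quadratic form of `b = a⁻¹`. -/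
lemma divergence_tangential_field {a b : E →L[ℝ] E} (hab : ∀ x, a (b x) = x)
    (ha : ∀ x y, inner ℝ (a x) y = inner ℝ x (a y)) {d : ℝ} {u : E → ℝ} {w : E → E} {x : E}
    (hu : DifferentiableAt ℝ u x) (hw : DifferentiableAt ℝ w x)
    (hwu : ∀ ξ, inner ℝ ξ (w x) = fderiv ℝ u x (a ξ)) (hdiv : divergence w x = 0)
    (heuler : fderiv ℝ u x x = d * u x) (ξ : E) (k : ℕ) {V : E → E}
    (hV : V = fun x =>
      (k * (inner ℝ x (b x) * (u x * inner ℝ ξ x ^ (k - 1)))) • a ξ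
        - (inner ℝ ξ x ^ k * inner ℝ x (b x)) • w x
        + ((d - k) * (u x * inner ℝ ξ x ^ k)) • x) :
    inner ℝ (b x) (V x) = 0 ∧
    divergence V x =
      k * ((k - 1 : ℕ) : ℝ) * inner ℝ ξ (a ξ) *
        (inner ℝ x (b x) * u x * inner ℝ ξ x ^ (k - 1 - 1))
      + (d - k) * (d + k + Module.finrank ℝ E - 2) * (u x * inner ℝ ξ x ^ k) := by
  have hb (y z : E) : inner ℝ (b y) z = inner ℝ y (b z) := by
    conv_lhs => rw [← hab z, ← ha, hab]
  have hbξ : inner ℝ (b x) (a ξ) = inner ℝ ξ x := by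
    rw [← ha, hab, real_inner_comm]
  have hbw : inner ℝ (b x) (w x) = d * u x := by rw [hwu, hab, heuler]
  have hbx : inner ℝ (b x) x = inner ℝ x (b x) := hb x x
  have hpow : (k : ℝ) * inner ℝ ξ x ^ (k - 1) * inner ℝ ξ x = k * inner ℝ ξ x ^ k := by
    rcases k with _ | k
    · simp
    · rw [Nat.add_sub_cancel, pow_succ]; ring
  have hq : HasFDerivAt (fun y : E => inner ℝ y (b y)) ((2 : ℝ) • innerSL ℝ (b x)) x :=
    hasFDerivAt_quadratic hb x
  have hl : HasFDerivAt (fun y : E => inner ℝ ξ y) (innerSL ℝ ξ) x := (innerSL ℝ ξ).hasFDerivAt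
  have h1 := (hq.fun_mul (hu.hasFDerivAt.fun_mul (hl.pow (k - 1)))).const_mul (k : ℝ)
  have h2 := (hl.pow k).fun_mul hq
  have h3 := (hu.hasFDerivAt.fun_mul (hl.pow k)).const_mul (d - k)
  subst hV
  constructor
  · simp only [inner_add_right, inner_sub_right, inner_smul_right, hbξ, hbw, hbx]
    linear_combination (inner ℝ x (b x) * u x) * hpow
  · rw [divergence_add, divergence_sub, divergence_smul h1 (by fun_prop), divergence_smul h2 hw,
      divergence_smul h3 (by fun_prop), divergence_const, divergence_id, hdiv]
    · simp only [add_apply, smul_apply, smul_eq_mul,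
        innerSL_apply_apply, nsmul_eq_mul, hbξ, hbw, hwu, heuler]
      linear_combination ((d - k) * u x + 2 * u x) * hpow
    · exact h1.differentiableAt.smul_const _
    · exact h2.differentiableAt.smul hw
    · exact (h1.differentiableAt.smul_const _).sub (h2.differentiableAt.smul hw)
    · exact h3.differentiableAt.smul differentiableAt_fun_id

variable [MeasurableSpace E] [BorelSpace E]

lemma integral_fderiv_apply_eq_zero {f : E → ℝ} (hf : ContDiff ℝ 1 f) (hc : HasCompactSupport f)
    (v : E) : ∫ x, fderiv ℝ f x v = 0 := by
  have h := integral_mul_fderiv_eq_neg_fderiv_mul_of_integrable (μ := (volume : Measure E))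
    (f := fun _ : E => (1 : ℝ)) (g := f) (v := v) (by simp)
    (by
      simp only [one_mul]
      exact ((hf.continuous_fderiv one_ne_zero).clm_apply continuous_const
        ).integrable_of_hasCompactSupport (hc.fderiv_apply ℝ v))
    (by
      simp only [one_mul]
      exact hf.continuous.integrable_of_hasCompactSupport hc)
    (fun x _ => by fun_prop) (fun x _ => hf.differentiable one_ne_zero x)
  simpa using h

/-- The divergence theorem for compactly supported vector fields. -/
lemma integral_divergence_eq_zero {V : E → E} (hV : ContDiff ℝ 1 V) (hc : HasCompactSupport V) :
    ∫ x, divergence V x = 0 := by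
  let b := stdOrthonormalBasis ℝ E
  have hcomp (i) : ContDiff ℝ 1 fun x => inner ℝ (b i) (V x) := contDiff_const.inner ℝ hV
  have hsupp (i) : HasCompactSupport fun x => inner ℝ (b i) (V x) :=
    hc.comp_left (g := fun y => inner ℝ (b i) y) (inner_zero_right _)
  have key (x : E) : divergence V x = ∑ i, fderiv ℝ (fun x => inner ℝ (b i) (V x)) x (b i) := by
    rw [divergence, LinearMap.trace_eq_sum_inner _ b]
    refine Finset.sum_congr rfl fun i _ => ?_
    rw [fderiv_inner_apply ℝ (differentiableAt_const _) (hV.differentiable one_ne_zero x)]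
    simp
  simp_rw [key]
  rw [integral_finsetSum]
  · exact Finset.sum_eq_zero fun i _ => integral_fderiv_apply_eq_zero (hcomp i) (hsupp i) _
  · intro i _
    exact (((hcomp i).continuous_fderiv one_ne_zero).clm_apply continuous_const
        ).integrable_of_hasCompactSupport ((hsupp i).fderiv_apply ℝ _)

/-- A compactly supported continuous function all of whose moments vanish is zero. -/
lemma eq_zero_of_moments_eq_zero {f : E → ℝ} (hf : Continuous f) (hc : HasCompactSupport f)
    (hmom : ∀ (ξ : E) (k : ℕ), ∫ x, f x * inner ℝ ξ x ^ k = 0) : f = 0 := by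
  have hcf : Continuous fun x => (f x : ℂ) := by fun_prop
  have hcc : HasCompactSupport fun x => (f x : ℂ) :=
    hc.comp_left (g := fun y : ℝ => (y : ℂ)) Complex.ofReal_zero
  have hInt : Integrable fun x => (f x : ℂ) := hcf.integrable_of_hasCompactSupport hcc
  have hF : FourierTransform.fourier (fun x => (f x : ℂ)) = 0 := by
    ext ξ
    rw [Real.fourier_eq']
    let G : ℕ → E → ℂ := fun k x =>
      (((-2 * Real.pi * inner ℝ x ξ : ℝ) : ℂ) * Complex.I) ^ k / (k.factorial : ℂ) * (f x : ℂ)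
    have hGc (k) : Continuous (G k) := by fun_prop
    have hGi (k) : Integrable (G k) :=
      (hGc k).integrable_of_hasCompactSupport (hcc.mul_left)
    obtain ⟨R, hR⟩ := hc.isCompact.isBounded.exists_norm_le
    have hbound (k : ℕ) (x : E) :
        ‖G k x‖ ≤ (2 * Real.pi * (R * ‖ξ‖)) ^ k / k.factorial * ‖(f x : ℂ)‖ := by
      by_cases hx : f x = 0
      · simp [G, hx]
      have hxR : ‖x‖ ≤ R := hR x (subset_tsupport f hx)
      simp only [G, norm_mul, norm_div, norm_pow, Complex.norm_I, mul_one, Complex.norm_natCast,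
        Complex.norm_real, norm_neg, Real.norm_ofNat, Real.norm_of_nonneg Real.pi_pos.le]
      gcongr
      exact (norm_inner_le_norm x ξ).trans (by gcongr)
    have hsum : Summable fun k => ∫ x, ‖G k x‖ := by
      refine Summable.of_nonneg_of_le (fun k => integral_nonneg fun x => norm_nonneg _)
        (fun k => integral_mono (hGi k).norm (hInt.norm.const_mul _) (hbound k)) ?_
      simp_rw [integral_const_mul]
      exact (Real.summable_pow_div_factorial _).mul_right _
    have h := hasSum_integral_of_summable_integral_norm hGi hsum
    have hzero (k : ℕ) : ∫ x, G k x = 0 := by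
      have : G k = fun x => (((-2 * Real.pi : ℝ) : ℂ) * Complex.I) ^ k / (k.factorial : ℂ) *
          ((f x * inner ℝ ξ x ^ k : ℝ) : ℂ) := by
        ext x
        simp only [G, real_inner_comm x ξ]
        push_cast
        ring
      rw [this, integral_const_mul, integral_complex_ofReal, hmom]
      simp
    simp_rw [hzero] at h
    have := h.unique hasSum_zero
    rw [Pi.zero_apply, ← this]
    congr 1
    ext x
    rw [smul_eq_mul, tsum_mul_right, Complex.exp_eq_exp_ℂ, NormedSpace.exp_eq_tsum_div]
  ext x
  have h := congrFun (hcf.fourierInv_fourier_eq hInt (by rw [hF]; exact integrable_zero _ _ _)) x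
  rw [hF, Real.fourierInv_eq] at h
  simpa using h.symm

open Topology in
lemma moments_eq_zero {a b : E →L[ℝ] E} (hab : ∀ x, a (b x) = x)
    (ha : ∀ x y, inner ℝ (a x) y = inner ℝ x (a y)) {c : ℝ} (hc : 0 < c)
    (hbc : ∀ x, c * ‖x‖ ^ 2 ≤ inner ℝ x (b x)) {d : ℝ}
    (hd : ∀ k : ℕ, (d - k) * (d + k + Module.finrank ℝ E - 2) ≠ 0) {u : E → ℝ} {w : E → E}
    (hu : ContDiffOn ℝ 1 u {0}ᶜ) (hw : ContDiffOn ℝ 1 w {0}ᶜ)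
    (hwu : ∀ x ≠ 0, ∀ ξ, inner ℝ ξ (w x) = fderiv ℝ u x (a ξ))
    (hdiv : ∀ x ≠ 0, divergence w x = 0)
    (heuler : ∀ x ≠ 0, fderiv ℝ u x x = d * u x) (ξ : E) (k : ℕ) :
    ∀ g : ℝ → ℝ, ContDiff ℝ 1 g → HasCompactSupport g → g =ᶠ[𝓝 0] 0 →
      ∫ x, g (inner ℝ x (b x)) * u x * inner ℝ ξ x ^ k = 0 := by
  have hb (y z : E) : inner ℝ (b y) z = inner ℝ y (b z) := by
    conv_lhs => rw [← hab z, ← ha, hab]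
  have hq : ContDiff ℝ 1 fun x : E => inner ℝ x (b x) := contDiff_id.inner ℝ b.contDiff
  have hev (g : ℝ → ℝ) (hg0 : g =ᶠ[𝓝 0] 0) : (fun x => g (inner ℝ x (b x))) =ᶠ[𝓝 0] 0 := by
    have : Filter.Tendsto (fun x : E => (inner ℝ x (b x) : ℝ)) (𝓝 0) (𝓝 0) := by
      simpa using hq.continuous.tendsto 0
    exact this.eventually hg0
  have hInt (g : ℝ → ℝ) (hg : ContDiff ℝ 1 g) (hgc : HasCompactSupport g) (hg0 : g =ᶠ[𝓝 0] 0)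
      (j : ℕ) : Integrable fun x => g (inner ℝ x (b x)) * u x * inner ℝ ξ x ^ j := by
    refine Continuous.integrable_of_hasCompactSupport ?_
      ((hasCompactSupport_comp_quadratic hc hbc hgc).mul_right.mul_right)
    exact (continuous_mul_of_eventuallyEq_zero (hg.continuous.comp hq.continuous) (hev g hg0)
      hu.continuousOn).mul (by fun_prop)
  induction k using Nat.strong_induction_on with
  | _ k ih =>
  intro g hg hgc hg0
  set v : E → E := fun x =>
      (k * (inner ℝ x (b x) * (u x * inner ℝ ξ x ^ (k - 1)))) • a ξ
        - (inner ℝ ξ x ^ k * inner ℝ x (b x)) • w x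
        + ((d - k) * (u x * inner ℝ ξ x ^ k)) • x with hv
  have hvC : ContDiffOn ℝ 1 v {0}ᶜ := by
    have hq' := hq.contDiffOn (s := {0}ᶜ)
    have hl : ContDiffOn ℝ 1 (fun y : E => inner ℝ ξ y) {0}ᶜ := (innerSL ℝ ξ).contDiff.contDiffOn
    exact (((contDiffOn_const.mul (hq'.mul (hu.mul (hl.pow _)))).smul contDiffOn_const).sub
      (((hl.pow _).mul hq').smul hw)).add
      ((contDiffOn_const.mul (hu.mul (hl.pow _))).smul contDiffOn_id)
  have hG : ContDiff ℝ 1 fun x => g (inner ℝ x (b x)) := hg.comp hq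
  have hdiv0 := integral_divergence_eq_zero
    (contDiff_smul_of_eventuallyEq_zero hG (hev g hg0) hvC)
    ((hasCompactSupport_comp_quadratic hc hbc hgc).smul_right)
  have hidg0 : (fun s => s * g s) =ᶠ[𝓝 0] 0 := by
    filter_upwards [hg0] with s hs
    simp [hs]
  have key (x : E) : divergence (fun x => g (inner ℝ x (b x)) • v x) x =
      k * ((k - 1 : ℕ) : ℝ) * inner ℝ ξ (a ξ) *
        ((fun s => s * g s) (inner ℝ x (b x)) * u x * inner ℝ ξ x ^ (k - 1 - 1))
      + (d - k) * (d + k + Module.finrank ℝ E - 2) *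
        (g (inner ℝ x (b x)) * u x * inner ℝ ξ x ^ k) := by
    rcases eq_or_ne x 0 with rfl | hx
    · have h0 : (fun x => g (inner ℝ x (b x)) • v x) =ᶠ[𝓝 0] fun _ => 0 := by
        filter_upwards [hev g hg0] with y hy
        simp [hy]
      have hg00 : g 0 = 0 := hg0.self_of_nhds
      rw [divergence, h0.fderiv_eq]
      simp [hg00]
    · have hnhds : ({0}ᶜ : Set E) ∈ 𝓝 x := isOpen_compl_singleton.mem_nhds hx
      obtain ⟨htan, hdv⟩ := divergence_tangential_field hab ha
        ((hu.contDiffAt hnhds).differentiableAt one_ne_zero)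
        ((hw.contDiffAt hnhds).differentiableAt one_ne_zero) (hwu x hx) (hdiv x hx)
        (heuler x hx) ξ k hv
      have hgq : HasFDerivAt (fun y => g (inner ℝ y (b y))) _ x :=
        (hg.differentiable one_ne_zero (inner ℝ x (b x))).hasDerivAt.comp_hasFDerivAt x
          (hasFDerivAt_quadratic hb x)
      rw [divergence_smul hgq ((hvC.contDiffAt hnhds).differentiableAt one_ne_zero), hdv]
      simp only [smul_apply, innerSL_apply_apply, htan]
      simp only [smul_zero, add_zero]
      ring
  have hidg : ContDiff ℝ 1 fun s => s * g s := contDiff_id.mul hg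
  have hidc : HasCompactSupport fun s => s * g s := hgc.mul_left
  simp_rw [key] at hdiv0
  rw [integral_add ((hInt _ hidg hidc hidg0 _).const_mul _) ((hInt _ hg hgc hg0 _).const_mul _),
    integral_const_mul, integral_const_mul] at hdiv0
  have hlow : (k : ℝ) * ((k - 1 : ℕ) : ℝ) * inner ℝ ξ (a ξ) *
      ∫ x, (fun s => s * g s) (inner ℝ x (b x)) * u x * inner ℝ ξ x ^ (k - 1 - 1) = 0 := by
    rcases k with _ | k
    · simp
    · rw [ih _ (by omega) _ hidg hidc hidg0, mul_zero]
  rw [hlow, zero_add] at hdiv0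
  exact (mul_eq_zero.mp hdiv0).resolve_left (hd k)

open Topology in
/-- A solution of a constant coefficient elliptic equation on the punctured space which is
homogeneous of a degree that is not attained by any spherical harmonic vanishes. -/
lemma eq_zero_of_divergence_eq_zero_of_homogeneous {a b : E →L[ℝ] E} (hab : ∀ x, a (b x) = x)
    (ha : ∀ x y, inner ℝ (a x) y = inner ℝ x (a y)) {c : ℝ} (hc : 0 < c)
    (hbc : ∀ x, c * ‖x‖ ^ 2 ≤ inner ℝ x (b x)) {d : ℝ}
    (hd : ∀ k : ℕ, (d - k) * (d + k + Module.finrank ℝ E - 2) ≠ 0) {u : E → ℝ} {w : E → E}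
    (hu : ContDiffOn ℝ 1 u {0}ᶜ) (hw : ContDiffOn ℝ 1 w {0}ᶜ)
    (hwu : ∀ x ≠ 0, ∀ ξ, inner ℝ ξ (w x) = fderiv ℝ u x (a ξ))
    (hdiv : ∀ x ≠ 0, divergence w x = 0)
    (heuler : ∀ x ≠ 0, fderiv ℝ u x x = d * u x) {x : E} (hx : x ≠ 0) : u x = 0 := by
  have hs : 0 < inner ℝ x (b x) :=
    lt_of_lt_of_le (mul_pos hc (pow_pos (norm_pos_iff.mpr hx) 2)) (hbc x)
  set s : ℝ := inner ℝ x (b x) with hs_def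
  let g : ContDiffBump s := ⟨s / 4, s / 2, by linarith, by linarith⟩
  have hg0 : (g : ℝ → ℝ) =ᶠ[𝓝 0] 0 := by
    filter_upwards [Iio_mem_nhds (show (0 : ℝ) < s / 2 by linarith)] with t ht
    refine g.zero_of_le_dist ?_
    have ht' : t < s / 2 := ht
    change s / 2 ≤ _
    rw [Real.dist_eq, abs_sub_comm]
    exact le_trans (by linarith) (le_abs_self _)
  have hq : Continuous fun x : E => inner ℝ x (b x) := by fun_prop
  have hev : (fun x => g (inner ℝ x (b x))) =ᶠ[𝓝 0] 0 := by
    have : Filter.Tendsto (fun x : E => (inner ℝ x (b x) : ℝ)) (𝓝 0) (𝓝 0) := by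
      simpa using hq.tendsto 0
    exact this.eventually hg0
  have h := eq_zero_of_moments_eq_zero
    (continuous_mul_of_eventuallyEq_zero (g.continuous.comp hq) hev hu.continuousOn)
    ((hasCompactSupport_comp_quadratic hc hbc g.hasCompactSupport).mul_right)
    (fun ξ k => moments_eq_zero hab ha hc hbc hd hu hw hwu hdiv heuler ξ k g g.contDiff
      g.hasCompactSupport hg0)
  have hxx := congrFun h x
  simp only [Function.comp] at hxx
  rw [← hs_def, g.one_of_mem_closedBall (by simp [g.rIn_pos.le])] at hxx
  simpa using hxx

end InnerProduct

section Matrix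

variable {n : ℕ}

lemma fderiv_apply_homogeneous {E : Type*} [NormedAddCommGroup E] [NormedSpace ℝ E] {f : E → ℝ}
    {d : ℝ} (hf : ∀ t : ℝ, 0 < t → ∀ x, x ≠ 0 → f (t • x) = t ^ d * f x) (v : E) :
    ∀ t : ℝ, 0 < t → ∀ x, x ≠ 0 → fderiv ℝ f (t • x) v = t ^ (d - 1) * fderiv ℝ f x v := by
  intro t ht x hx
  have h1 : (fun y => f (t • y)) =ᶠ[nhds x] t ^ d • f := by
    filter_upwards [isOpen_compl_singleton.mem_nhds (show x ∈ ({0}ᶜ : Set E) from hx)] with y hy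
    exact hf t ht y hy
  have h2 := congrArg (fun L : E →L[ℝ] ℝ => L v) h1.fderiv_eq
  rw [fderiv_comp_smul, fderiv_const_smul_field] at h2
  have h3 : t * fderiv ℝ f (t • x) v = t ^ d * fderiv ℝ f x v := by simpa using h2
  rw [Real.rpow_sub_one ht.ne']
  field_simp
  rw [mul_comm, h3]

lemma fderiv_apply_self_of_homogeneous {E : Type*} [NormedAddCommGroup E] [NormedSpace ℝ E]
    {f : E → ℝ} {d : ℝ} (hf : ∀ t : ℝ, 0 < t → ∀ x, x ≠ 0 → f (t • x) = t ^ d * f x) {x : E}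
    (hx : x ≠ 0) (hfx : DifferentiableAt ℝ f x) : fderiv ℝ f x x = d * f x := by
  have h1 : HasDerivAt (fun t : ℝ => f (t • x)) (fderiv ℝ f x x) 1 := by
    have hl : HasDerivAt (fun t : ℝ => t • x) x 1 := by
      simpa using (hasDerivAt_id (1 : ℝ)).smul_const x
    have hfx' : HasFDerivAt f (fderiv ℝ f x) ((1 : ℝ) • x) := by simpa using hfx.hasFDerivAt
    exact hfx'.comp_hasDerivAt 1 hl
  have h2 : HasDerivAt (fun t : ℝ => t ^ d * f x) (d * f x) 1 := by
    simpa using (Real.hasDerivAt_rpow_const (x := 1) (p := d) (Or.inl one_ne_zero)).mul_const (f x)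
  refine h1.unique (h2.congr_of_eventuallyEq ?_)
  filter_upwards [Ioi_mem_nhds (zero_lt_one' ℝ)] with t ht
  exact hf t ht x hx

lemma hessian_smul {u : EuclideanSpace ℝ (Fin n) → ℝ} {d : ℝ}
    (hu : ∀ t : ℝ, 0 < t → ∀ x, x ≠ 0 → u (t • x) = t ^ d * u x) {t : ℝ} (ht : 0 < t)
    {x : EuclideanSpace ℝ (Fin n)} (hx : x ≠ 0) :
    hessian u (t • x) = t ^ (d - 2) • hessian u x := by
  ext i j
  have h := fderiv_apply_homogeneous
    (f := fun y => fderiv ℝ u y (EuclideanSpace.single j (1 : ℝ)))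
    (fderiv_apply_homogeneous hu (EuclideanSpace.single j (1 : ℝ))) (EuclideanSpace.single i 1)
    t ht x hx
  rw [sub_sub, one_add_one_eq_two] at h
  simpa [hessian] using h

lemma hessian_isSymm {u : EuclideanSpace ℝ (Fin n) → ℝ} {x : EuclideanSpace ℝ (Fin n)}
    (hu : ContDiffAt ℝ 2 u x) : (hessian u x).IsSymm := by
  have hd : DifferentiableAt ℝ (fderiv ℝ u) x :=
    (hu.fderiv_right (m := 1) (by norm_num)).differentiableAt one_ne_zero
  have hij (i j : Fin n) : hessian u x i j =
      fderiv ℝ (fderiv ℝ u) x (EuclideanSpace.single i 1) (EuclideanSpace.single j 1) := by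
    simp [hessian, fderiv_clm_apply hd (differentiableAt_const _)]
  ext i j
  rw [Matrix.transpose_apply, hij, hij]
  exact hu.isSymmSndFDerivAt (by simp) _ _

lemma fderiv_zero_apply_eq_zero_of_ray {E : Type*} [NormedAddCommGroup E] [NormedSpace ℝ E]
    {F : E → ℝ} (hF : DifferentiableAt ℝ F 0) {H : E}
    (hH : ∀ s : ℝ, 0 < s → F (s • H) = 0) : fderiv ℝ F 0 H = 0 := by
  have hl : HasDerivAt (fun s : ℝ => s • H) H 0 := by
    simpa using (hasDerivAt_id (0 : ℝ)).smul_const H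
  have hF' : HasFDerivAt F (fderiv ℝ F 0) ((0 : ℝ) • H) := by simpa using hF.hasFDerivAt
  have h1 : HasDerivAt (fun s : ℝ => F (s • H)) (fderiv ℝ F 0 H) 0 := hF'.comp_hasDerivAt 0 hl
  have h0 : F ((0 : ℝ) • H) = 0 := by
    have ht : Filter.Tendsto (fun s : ℝ => F (s • H)) (nhdsWithin 0 (Set.Ioi 0))
        (nhds (F ((0 : ℝ) • H))) := h1.continuousAt.tendsto.mono_left nhdsWithin_le_nhds
    refine tendsto_nhds_unique ht (tendsto_const_nhds.congr' ?_)
    filter_upwards [self_mem_nhdsWithin] with s hs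
    exact (hH s hs).symm
  refine (uniqueDiffWithinAt_Ici (0 : ℝ)).eq_deriv _ h1.hasDerivWithinAt
    ((hasDerivWithinAt_const 0 _ (0 : ℝ)).congr (fun s hs => ?_) h0)
  rcases eq_or_lt_of_le (Set.mem_Ici.mp hs) with rfl | hs'
  · exact h0
  · exact hH s hs'

lemma exists_isSymm_coefficients (T : Matrix (Fin n) (Fin n) ℝ →ₗ[ℝ] ℝ) :
    ∃ A : Matrix (Fin n) (Fin n) ℝ, A.IsSymm ∧
      ∀ M : Matrix (Fin n) (Fin n) ℝ, M.IsSymm → T M = ∑ i, ∑ j, A i j * M i j := by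
  refine ⟨Matrix.of fun i j => (T (.single i j 1) + T (.single j i 1)) / 2, ?_, fun M hM => ?_⟩
  · ext i j
    simp [add_comm]
  · have h1 : T M = ∑ i, ∑ j, M i j * T (.single i j 1) := by
      conv_lhs => rw [Matrix.matrix_eq_sum_single M]
      simp only [map_sum]
      refine Finset.sum_congr rfl fun i _ => Finset.sum_congr rfl fun j _ => ?_
      rw [← smul_eq_mul, ← map_smul, Matrix.smul_single, smul_eq_mul, mul_one]
    have h2 : T M = ∑ i, ∑ j, M i j * T (.single j i 1) := by
      rw [h1, Finset.sum_comm]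
      refine Finset.sum_congr rfl fun i _ => Finset.sum_congr rfl fun j _ => ?_
      rw [hM.apply]
    have h3 : T M = (T M + T M) / 2 := by ring
    rw [h3]
    nth_rewrite 1 [h1]
    rw [h2, ← Finset.sum_add_distrib, Finset.sum_div]
    refine Finset.sum_congr rfl fun i _ => ?_
    rw [← Finset.sum_add_distrib, Finset.sum_div]
    refine Finset.sum_congr rfl fun j _ => ?_
    simp only [Matrix.of_apply]
    ring

lemma exists_coercive_right_inverse {E : Type*} [NormedAddCommGroup E] [InnerProductSpace ℝ E]
    [FiniteDimensional ℝ E] {a : E →L[ℝ] E} {μ : ℝ} (hμ : 0 < μ)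
    (ha : ∀ x, μ * ‖x‖ ^ 2 ≤ inner ℝ x (a x)) :
    ∃ b : E →L[ℝ] E, (∀ x, a (b x) = x) ∧
      ∃ c : ℝ, 0 < c ∧ ∀ x, c * ‖x‖ ^ 2 ≤ inner ℝ x (b x) := by
  have hinj : Function.Injective (a : E →ₗ[ℝ] E) := by
    rw [injective_iff_map_eq_zero]
    intro x hx
    have h := ha x
    rw [show a x = 0 from hx, inner_zero_right] at h
    have h2 : ‖x‖ ^ 2 ≤ 0 := nonpos_of_mul_nonpos_right h hμ
    exact norm_eq_zero.mp (pow_eq_zero_iff two_ne_zero |>.mp (le_antisymm h2 (sq_nonneg _)))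
  let e := LinearEquiv.ofInjectiveEndo (a : E →ₗ[ℝ] E) hinj
  have hab (x : E) : a (e.symm x) = x := e.apply_symm_apply x
  refine ⟨LinearMap.toContinuousLinearMap (e.symm : E →ₗ[ℝ] E), hab,
    μ / (‖a‖ + 1) ^ 2, by positivity, fun x => ?_⟩
  change _ ≤ inner ℝ x (e.symm x)
  have h1 := ha (e.symm x)
  rw [hab, real_inner_comm] at h1
  refine le_trans ?_ h1
  have h2 : ‖x‖ ≤ (‖a‖ + 1) * ‖e.symm x‖ := by
    have := a.le_opNorm (e.symm x)
    rw [hab] at this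
    linarith [norm_nonneg (e.symm x)]
  have h3 : ‖x‖ ^ 2 ≤ (‖a‖ + 1) ^ 2 * ‖e.symm x‖ ^ 2 := by
    rw [← mul_pow]
    gcongr
  rw [div_mul_eq_mul_div, div_le_iff₀ (by positivity)]
  linarith [mul_le_mul_of_nonneg_left h3 hμ.le]

/-- The field `A ∇u`. -/
noncomputable def conormalField (A : Matrix (Fin n) (Fin n) ℝ)
    (u : EuclideanSpace ℝ (Fin n) → ℝ) (x : EuclideanSpace ℝ (Fin n)) :
    EuclideanSpace ℝ (Fin n) :=
  ∑ i, fderiv ℝ u x (EuclideanSpace.single i 1) •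
    Matrix.toEuclideanCLM (n := Fin n) (𝕜 := ℝ) A (EuclideanSpace.single i 1)

lemma sum_smul_single (x : EuclideanSpace ℝ (Fin n)) :
    ∑ i, x i • EuclideanSpace.single i (1 : ℝ) = x := by
  simpa using (EuclideanSpace.basisFun (Fin n) ℝ).sum_repr x

lemma toEuclideanCLM_single (A : Matrix (Fin n) (Fin n) ℝ) (i : Fin n) :
    Matrix.toEuclideanCLM (n := Fin n) (𝕜 := ℝ) A (EuclideanSpace.single i 1) =
      ∑ j, A j i • EuclideanSpace.single j (1 : ℝ) := by
  rw [← sum_smul_single (Matrix.toEuclideanCLM (n := Fin n) (𝕜 := ℝ) A _)]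
  simp

lemma inner_toEuclideanCLM_comm {A : Matrix (Fin n) (Fin n) ℝ} (hA : A.IsSymm)
    (x y : EuclideanSpace ℝ (Fin n)) :
    inner ℝ (Matrix.toEuclideanCLM (n := Fin n) (𝕜 := ℝ) A x) y =
      inner ℝ x (Matrix.toEuclideanCLM (n := Fin n) (𝕜 := ℝ) A y) := by
  rw [real_inner_comm, Matrix.inner_toEuclideanCLM, Matrix.inner_toEuclideanCLM]
  nth_rewrite 1 [← hA]
  rw [Matrix.mulVec_transpose, dotProduct_comm, ← Matrix.dotProduct_mulVec]

lemma inner_conormalField {A : Matrix (Fin n) (Fin n) ℝ} (hA : A.IsSymm)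
    (u : EuclideanSpace ℝ (Fin n) → ℝ) (x ξ : EuclideanSpace ℝ (Fin n)) :
    inner ℝ ξ (conormalField A u x) =
      fderiv ℝ u x (Matrix.toEuclideanCLM (n := Fin n) (𝕜 := ℝ) A ξ) := by
  conv_rhs => rw [← sum_smul_single (Matrix.toEuclideanCLM (n := Fin n) (𝕜 := ℝ) A ξ)]
  rw [conormalField, inner_sum, map_sum]
  refine Finset.sum_congr rfl fun i _ => ?_
  rw [map_smul, inner_smul_right, ← inner_toEuclideanCLM_comm hA, EuclideanSpace.inner_single_right]
  simp [mul_comm]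

lemma divergence_conormalField (A : Matrix (Fin n) (Fin n) ℝ)
    {u : EuclideanSpace ℝ (Fin n) → ℝ} {x : EuclideanSpace ℝ (Fin n)}
    (hu : ContDiffAt ℝ 2 u x) :
    divergence (conormalField A u) x = ∑ i, ∑ j, A i j * hessian u x i j := by
  have hd : DifferentiableAt ℝ (fderiv ℝ u) x :=
    (hu.fderiv_right (m := 1) (by norm_num)).differentiableAt one_ne_zero
  have hdi (i : Fin n) : DifferentiableAt ℝ
      (fun y => fderiv ℝ u y (EuclideanSpace.single i (1 : ℝ))) x :=
    hd.clm_apply (differentiableAt_const _)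
  unfold conormalField
  rw [divergence_sum fun i _ => (hdi i).smul_const _, Finset.sum_comm]
  refine Finset.sum_congr rfl fun j _ => ?_
  rw [divergence_smul (hdi j).hasFDerivAt (differentiableAt_const _), divergence_const, mul_zero,
    zero_add, toEuclideanCLM_single, map_sum]
  refine Finset.sum_congr rfl fun i _ => ?_
  rw [map_smul, smul_eq_mul]
  rfl

lemma contDiffOn_conormalField (A : Matrix (Fin n) (Fin n) ℝ)
    {u : EuclideanSpace ℝ (Fin n) → ℝ} {s : Set (EuclideanSpace ℝ (Fin n))} (hs : IsOpen s)
    (hu : ContDiffOn ℝ 2 u s) : ContDiffOn ℝ 1 (conormalField A u) s := by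
  have h := hu.fderiv_of_isOpen (m := 1) hs (by norm_num)
  exact ContDiffOn.sum fun i _ => (h.clm_apply contDiffOn_const).smul contDiffOn_const

end Matrix

lemma degree_factor_ne_zero {n : ℕ} {d : ℝ}
    (hd : (¬ ∃ k : ℤ, d = (k : ℝ)) ∨ (-((n : ℝ) - 2) < d ∧ d < 0)) (k : ℕ) :
    (d - k) * (d + k + n - 2) ≠ 0 := by
  have hk : (0 : ℝ) ≤ k := k.cast_nonneg
  rcases hd with hd | ⟨h1, h2⟩
  · refine mul_ne_zero (fun h => hd ⟨k, ?_⟩) (fun h => hd ⟨2 - k - n, ?_⟩)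
    · push_cast; linarith
    · push_cast; linarith
  · exact mul_ne_zero (by linarith) (by linarith)

theorem stmt1 {n : ℕ} (hn : 2 ≤ n) (μ : ℝ) (hμ : 0 < μ) (hμ1 : μ ≤ 1)
    (d : ℝ) (hd : d ≠ 2)
    (hd' : (¬ ∃ k : ℤ, d = (k : ℝ)) ∨ (-((n : ℝ) - 2) < d ∧ d < 0))
    (F : Matrix (Fin n) (Fin n) ℝ → ℝ)
    (hF : ContDiff ℝ 1 F)
    (hFell : ∀ M : Matrix (Fin n) (Fin n) ℝ, M.IsSymm →
      ∀ P : Matrix (Fin n) (Fin n) ℝ, P.IsSymm → P.PosSemidef →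
        μ * P.trace ≤ fderiv ℝ F M P ∧ fderiv ℝ F M P ≤ μ⁻¹ * P.trace)
    (u : EuclideanSpace ℝ (Fin n) → ℝ)
    (hu : ContDiffOn ℝ 2 u {(0 : EuclideanSpace ℝ (Fin n))}ᶜ)
    (hhom : ∀ t : ℝ, 0 < t → ∀ x : EuclideanSpace ℝ (Fin n), x ≠ 0 →
      u (t • x) = t ^ d * u x)
    (hsol : ∀ x : EuclideanSpace ℝ (Fin n), x ≠ 0 → F (hessian u x) = 0) :
    ∀ x : EuclideanSpace ℝ (Fin n), x ≠ 0 → u x = 0 := by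
  have huAt (x : EuclideanSpace ℝ (Fin n)) (hx : x ≠ 0) : ContDiffAt ℝ 2 u x :=
    hu.contDiffAt (isOpen_compl_singleton.mem_nhds hx)
  obtain ⟨A, hA, hT⟩ :=
    exists_isSymm_coefficients (fderiv ℝ F 0 : Matrix (Fin n) (Fin n) ℝ →ₗ[ℝ] ℝ)
  have hlin (x : EuclideanSpace ℝ (Fin n)) (hx : x ≠ 0) :
      divergence (conormalField A u) x = 0 := by
    rw [divergence_conormalField A (huAt x hx), ← hT _ (hessian_isSymm (huAt x hx))]
    refine fderiv_zero_apply_eq_zero_of_ray (hF.differentiable one_ne_zero 0) fun s hs => ?_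
    have hpos : 0 < s ^ (d - 2)⁻¹ := Real.rpow_pos_of_pos hs _
    have h := hessian_smul hhom hpos hx
    rw [Real.rpow_inv_rpow hs.le (sub_ne_zero.mpr hd)] at h
    rw [← h]
    exact hsol _ (smul_ne_zero hpos.ne' hx)
  have hcoer (x : EuclideanSpace ℝ (Fin n)) :
      μ * ‖x‖ ^ 2 ≤ inner ℝ x (Matrix.toEuclideanCLM (n := Fin n) (𝕜 := ℝ) A x) := by
    have hsymm : (Matrix.vecMulVec x x : Matrix (Fin n) (Fin n) ℝ).IsSymm := by
      ext i j
      simp [Matrix.vecMulVec_apply, mul_comm]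
    have hpsd : (Matrix.vecMulVec x x : Matrix (Fin n) (Fin n) ℝ).PosSemidef := by
      simpa using Matrix.posSemidef_vecMulVec_self_star (x : Fin n → ℝ)
    have h := (hFell 0 (by simp) _ hsymm hpsd).1
    have hTx := hT _ hsymm
    have htr : (Matrix.vecMulVec x x : Matrix (Fin n) (Fin n) ℝ).trace = ‖x‖ ^ 2 := by
      rw [EuclideanSpace.real_norm_sq_eq]
      simp [Matrix.trace, Matrix.vecMulVec_apply, sq]
    rw [htr] at h
    refine h.trans (hTx.trans ?_).le
    rw [Matrix.inner_toEuclideanCLM]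
    simp only [dotProduct, Matrix.mulVec, Finset.mul_sum, Matrix.vecMulVec_apply]
    refine Finset.sum_congr rfl fun i _ => Finset.sum_congr rfl fun j _ => ?_
    ring
  obtain ⟨b, hab, c, hc, hbc⟩ := exists_coercive_right_inverse hμ hcoer
  intro x hx
  exact eq_zero_of_divergence_eq_zero_of_homogeneous hab (inner_toEuclideanCLM_comm hA) hc hbc
    (d := d) (by simpa using degree_factor_ne_zero hd') (hu.of_le (by norm_num))
    (contDiffOn_conormalField A isOpen_compl_singleton hu)
    (fun y _ ξ => inner_conormalField hA u y ξ) hlin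
    (fun y hy => fderiv_apply_self_of_homogeneous hhom hy
      ((huAt y hy).differentiableAt two_ne_zero)) hx
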